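/- arXiv:1904.08686 — 6 statements merged into one kernel-verified Lean document; each statement's English description precedes it below -/
import Mathlib

section
/- Let s ≤ m and n be natural numbers, let Ω be the m×m complex block-diagonal matrix blkdiag(I_s, 0), and let A be an arbitrary m×n complex matrix. Then tr((AᴴΩA + Iₙ)⁻¹) ≥ tr((AᴴA + Iₙ)⁻¹). (Both AᴴΩA + Iₙ and AᴴA + Iₙ are Hermitian positive definite, hence invertible.) -/
open Matrix
open scoped ComplexOrder

/-- Inversion of positive definite matrices is antitone in the Loewner order. -/
theorem Matrix.PosDef.posSemidef_inv_sub_inv {ι 𝕜 : Type*} [Fintype ι] [DecidableEq ι]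
    [RCLike 𝕜] {P Q : Matrix ι ι 𝕜} (hP : P.PosDef) (hPQ : (Q - P).PosSemidef) :
    (P⁻¹ - Q⁻¹).PosSemidef := by
  obtain ⟨D, rfl⟩ : ∃ D, Q = P + D := ⟨Q - P, by abel⟩
  rw [add_sub_cancel_left] at hPQ
  have hQ : (P + D).PosDef := hP.add_posSemidef hPQ
  have hPu : IsUnit P.det := (Matrix.isUnit_iff_isUnit_det _).mp hP.isUnit
  have hQu : IsUnit (P + D).det := (Matrix.isUnit_iff_isUnit_det _).mp hQ.isUnit
  have key : D + D * P⁻¹ * D = (P + D) * (P⁻¹ - (P + D)⁻¹) * (P + D) := by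
    rw [mul_sub, Matrix.mul_nonsing_inv _ hQu, add_mul, Matrix.mul_nonsing_inv _ hPu,
      add_sub_cancel_left, mul_add, Matrix.nonsing_inv_mul_cancel_right _ _ hPu]
  have hmid : (D + D * P⁻¹ * D).PosSemidef := by
    have h := hP.inv.posSemidef.conjTranspose_mul_mul_same D
    rw [hPQ.isHermitian.eq] at h
    exact hPQ.add h
  have h := hmid.conjTranspose_mul_mul_same (P + D)⁻¹
  rwa [hQ.inv.isHermitian.eq, key, mul_assoc (P + D), Matrix.nonsing_inv_mul_cancel_left _ _ hQu,
    Matrix.mul_nonsing_inv_cancel_right _ _ hQu] at h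

/-- Proposition 1 of the paper: with `Ω = blkdiag(I_s, 0)` (an `m × m` matrix),
for any `m × n` complex matrix `A`,
`tr((AᴴΩA + Iₙ)⁻¹) ≥ tr((AᴴA + Iₙ)⁻¹)`. -/
theorem trace_inv_omega_ge {s m n : ℕ} (hsm : s ≤ m)
    (Ω : Matrix (Fin m) (Fin m) ℂ)
    (hΩ : Ω = Matrix.diagonal (fun i : Fin m => if (i : ℕ) < s then (1 : ℂ) else 0))
    (A : Matrix (Fin m) (Fin n) ℂ) :
    (Aᴴ * Ω * A + 1)⁻¹.trace ≥ (Aᴴ * A + 1)⁻¹.trace := by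
  have hΩ₀ : Ω.PosSemidef := by
    rw [hΩ, Matrix.posSemidef_diagonal_iff]
    intro i
    split_ifs <;> simp
  have hΩ₁ : (1 - Ω).PosSemidef := by
    rw [hΩ, ← Matrix.diagonal_one, Matrix.diagonal_sub, Matrix.posSemidef_diagonal_iff]
    intro i
    split_ifs <;> simp
  have hP : (Aᴴ * Ω * A + 1).PosDef :=
    Matrix.PosDef.posSemidef_add (hΩ₀.conjTranspose_mul_mul_same A) Matrix.PosDef.one
  have hPQ : (Aᴴ * A + 1 - (Aᴴ * Ω * A + 1)).PosSemidef := by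
    simpa [Matrix.mul_sub, Matrix.sub_mul] using hΩ₁.conjTranspose_mul_mul_same A
  have h := (hP.posSemidef_inv_sub_inv hPQ).trace_nonneg
  rwa [Matrix.trace_sub, sub_nonneg] at h
end

section
/- Let H be an N_R×N_t complex matrix, W a nonzero N_R×N_S complex matrix, V_RF an N_t×N_RF complex matrix with full column rank such that V_RFᴴHᴴW ≠ 0, and let σ > 0 and P > 0 be reals. For an N_RF×N_S complex matrix V_D and a real β > 0, define the sum-MSE J(V_D, β) = tr(β² WᴴH V_RF V_D V_Dᴴ V_RFᴴ Hᴴ W + β²σ² WᴴW + I_{N_S}) − 2·Re(tr(β V_Dᴴ V_RFᴴ Hᴴ W)). Set λ = σ²·tr(WᴴW)/P, Ṽ_D = (V_RFᴴHᴴWWᴴHV_RF + λ·V_RFᴴV_RF)⁻¹ V_RFᴴHᴴW, β★ = √(tr(V_RF Ṽ_D Ṽ_Dᴴ V_RFᴴ)/P), and V_D★ = (1/β★)·Ṽ_D. Then β★ > 0, tr(V_RF V_D★ V_D★ᴴ V_RFᴴ) ≤ P, and for every N_RF×N_S complex matrix V_D and every real β > 0 satisfying the transmit power constraint tr(V_RF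 V_D V_Dᴴ V_RFᴴ) ≤ P, it holds that J(V_D★, β★) ≤ J(V_D, β). -/
open Matrix
open scoped ComplexOrder

/-- If `M` is positive semidefinite and `M * Y = B`, then `Y` minimizes the quadratic functional
`X ↦ Re tr(Xᴴ M X) - 2 Re tr(Xᴴ B)`. -/
theorem Matrix.PosSemidef.re_trace_quadratic_le {m n : Type*} [Fintype m] [Fintype n]
    {M : Matrix m m ℂ} (hM : M.PosSemidef) {Y B : Matrix m n ℂ} (hY : M * Y = B)
    (X : Matrix m n ℂ) :
    (Yᴴ * M * Y).trace.re - 2 * (Yᴴ * B).trace.re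
      ≤ (Xᴴ * M * X).trace.re - 2 * (Xᴴ * B).trace.re := by
  have hsq : 0 ≤ ((X - Y)ᴴ * M * (X - Y)).trace.re :=
    (Complex.le_def.mp (hM.conjTranspose_mul_mul_same (X - Y)).trace_nonneg).1
  have hcross : (Yᴴ * M * X).trace.re = (Xᴴ * M * Y).trace.re := by
    have h : (Yᴴ * M * X)ᴴ = Xᴴ * M * Y := by
      simp [conjTranspose_mul, hM.isHermitian.eq, Matrix.mul_assoc]
    rw [← h, trace_conjTranspose, Complex.star_def, Complex.conj_re]
  have hexp : ((X - Y)ᴴ * M * (X - Y)).trace.re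
      = (Xᴴ * M * X).trace.re - (Xᴴ * M * Y).trace.re
        - ((Yᴴ * M * X).trace.re - (Yᴴ * M * Y).trace.re) := by
    simp only [conjTranspose_sub, Matrix.sub_mul, Matrix.mul_sub, trace_sub, Complex.sub_re]
    ring
  subst hY
  simp only [← Matrix.mul_assoc]
  linarith

/-- The squared Frobenius norm of a nonzero complex matrix is positive. -/
theorem Matrix.re_trace_conjTranspose_mul_self_pos {m n : Type*} [Fintype m] [Fintype n]
    {A : Matrix m n ℂ} (hA : A ≠ 0) : 0 < (Aᴴ * A).trace.re := by
  have h : 0 < (Aᴴ * A).trace :=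
    lt_of_le_of_ne (posSemidef_conjTranspose_mul_self A).trace_nonneg
      fun h => hA (trace_conjTranspose_mul_self_eq_zero_iff.mp h.symm)
  exact (Complex.lt_def.mp h).1

/-- The transmit power scales quadratically with the digital precoder. -/
theorem Matrix.re_trace_transmit_smul {m n k : Type*} [Fintype m] [Fintype n] [Fintype k]
    (F : Matrix m n ℂ) (V : Matrix n k ℂ) (r : ℝ) :
    (((r : ℂ) • V)ᴴ * (Fᴴ * F) * ((r : ℂ) • V)).trace.re
      = r ^ 2 * (F * V * Vᴴ * Fᴴ).trace.re := by
  have h : (Vᴴ * (Fᴴ * F) * V).trace = (F * V * Vᴴ * Fᴴ).trace := by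
    rw [Matrix.mul_assoc (F * V), trace_mul_comm (F * V)]
    simp only [Matrix.mul_assoc]
  rw [← h]
  simp only [conjTranspose_smul, Matrix.smul_mul, Matrix.mul_smul, smul_smul, trace_smul,
    Complex.star_def, Complex.conj_ofReal, smul_eq_mul, ← Complex.ofReal_mul,
    Complex.re_ofReal_mul]
  ring

/-- KKT-based optimal digital precoder and scaling factor (Section III-A of the paper):
with fixed analog precoder `V_RF` (full column rank) and combiner `W ≠ 0`,
the digital precoder `V_D★ = (1/β★)Ṽ_D` with
`Ṽ_D = (V_RFᴴHᴴWWᴴHV_RF + λ V_RFᴴV_RF)⁻¹ V_RFᴴHᴴW`, `λ = σ²tr(WᴴW)/P` and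
`β★ = √(tr(V_RF Ṽ_D Ṽ_Dᴴ V_RFᴴ)/P)` satisfies the power constraint and minimizes
the sum-MSE `J` among all feasible `(V_D, β)` with `β > 0`. -/
theorem optimal_digital_precoder
    {N_R N_t N_RF N_S : ℕ}
    (H : Matrix (Fin N_R) (Fin N_t) ℂ) (W : Matrix (Fin N_R) (Fin N_S) ℂ)
    (V_RF : Matrix (Fin N_t) (Fin N_RF) ℂ)
    (hW : W ≠ 0)
    (hrank : LinearIndependent ℂ (fun j : Fin N_RF => fun i : Fin N_t => V_RF i j))
    (hWH : V_RFᴴ * Hᴴ * W ≠ 0)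
    (σ P : ℝ) (hσ : 0 < σ) (hP : 0 < P)
    (J : Matrix (Fin N_RF) (Fin N_S) ℂ → ℝ → ℝ)
    (hJ : ∀ V_D β, J V_D β =
      (((β : ℂ) ^ 2 • (Wᴴ * H * V_RF * V_D * V_Dᴴ * V_RFᴴ * Hᴴ * W)
        + ((β : ℂ) ^ 2 * (σ : ℂ) ^ 2) • (Wᴴ * W) + 1).trace).re
      - 2 * (((β : ℂ) • (V_Dᴴ * V_RFᴴ * Hᴴ * W)).trace).re)
    (lam : ℝ) (hlam : lam = σ ^ 2 * ((Wᴴ * W).trace).re / P)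
    (Vt : Matrix (Fin N_RF) (Fin N_S) ℂ)
    (hVt : Vt =
      (V_RFᴴ * Hᴴ * W * Wᴴ * H * V_RF + (lam : ℂ) • (V_RFᴴ * V_RF))⁻¹ * (V_RFᴴ * Hᴴ * W))
    (βs : ℝ) (hβs : βs = Real.sqrt (((V_RF * Vt * Vtᴴ * V_RFᴴ).trace).re / P))
    (VDs : Matrix (Fin N_RF) (Fin N_S) ℂ) (hVDs : VDs = ((βs : ℂ))⁻¹ • Vt) :
    0 < βs ∧ ((V_RF * VDs * VDsᴴ * V_RFᴴ).trace).re ≤ P ∧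
    ∀ (V_D : Matrix (Fin N_RF) (Fin N_S) ℂ) (β : ℝ), 0 < β →
      ((V_RF * V_D * V_Dᴴ * V_RFᴴ).trace).re ≤ P →
      J VDs βs ≤ J V_D β := by
  set B := V_RFᴴ * Hᴴ * W with hB
  have hBH : Bᴴ = Wᴴ * H * V_RF := by simp [hB, Matrix.mul_assoc]
  set M := B * Bᴴ + (lam : ℂ) • (V_RFᴴ * V_RF) with hM
  have hMdef : B * Wᴴ * H * V_RF + (lam : ℂ) • (V_RFᴴ * V_RF) = M := by
    simp only [hM, hBH, Matrix.mul_assoc]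
  rw [hMdef] at hVt
  have hlam_pos : 0 < lam := by
    have := re_trace_conjTranspose_mul_self_pos hW
    rw [hlam]
    positivity
  have hlamP : lam * P = σ ^ 2 * (Wᴴ * W).trace.re := by
    rw [hlam]
    field_simp
  have hMpos : M.PosDef := by
    have hG : (V_RFᴴ * V_RF).PosDef :=
      PosDef.conjTranspose_mul_self _ (mulVec_injective_iff.mpr hrank)
    exact PosDef.posSemidef_add (posSemidef_self_mul_conjTranspose B)
      (hG.smul (by exact_mod_cast hlam_pos))
  have hMVt : M * Vt = B := by
    rw [hVt, mul_nonsing_inv_cancel_left _ _ ((isUnit_iff_isUnit_det M).mp hMpos.isUnit)]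
  have hFVt : V_RF * Vt ≠ 0 := by
    intro h
    apply hWH
    rw [← hMVt, hM, hBH]
    simp [Matrix.add_mul, Matrix.mul_assoc, h]
  have hpow_pos : 0 < (V_RF * Vt * Vtᴴ * V_RFᴴ).trace.re := by
    have h := re_trace_conjTranspose_mul_self_pos hFVt
    rwa [trace_mul_comm, conjTranspose_mul, ← Matrix.mul_assoc] at h
  have hβs_pos : 0 < βs := by
    rw [hβs]
    positivity
  have hβs_sq : βs ^ 2 * P = (V_RF * Vt * Vtᴴ * V_RFᴴ).trace.re := by
    rw [hβs, Real.sq_sqrt (by positivity)]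
    field_simp
  have hβVDs : (βs : ℂ) • VDs = Vt := by
    rw [hVDs, smul_inv_smul₀ (by exact_mod_cast hβs_pos.ne')]
  have hpow_eq : (V_RF * VDs * VDsᴴ * V_RFᴴ).trace.re = P := by
    have h := re_trace_transmit_smul V_RF VDs βs
    have h' := re_trace_transmit_smul V_RF Vt 1
    rw [hβVDs] at h
    simp only [Complex.ofReal_one, one_smul, one_pow, one_mul] at h'
    rw [h', ← hβs_sq] at h
    exact (mul_left_cancel₀ (by positivity) h).symm
  -- Completing the power term turns `J` into the unconstrained functional plus the slack.
  have hJ_eq : ∀ (V : Matrix (Fin N_RF) (Fin N_S) ℂ) (β : ℝ),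
      J V β = (((β : ℂ) • V)ᴴ * M * ((β : ℂ) • V)).trace.re
        - 2 * (((β : ℂ) • V)ᴴ * B).trace.re + (1 : Matrix (Fin N_S) (Fin N_S) ℂ).trace.re
        + lam * β ^ 2 * (P - (V_RF * V * Vᴴ * V_RFᴴ).trace.re) := by
    intro V β
    have hsig : (Wᴴ * H * V_RF * V * Vᴴ * V_RFᴴ * Hᴴ * W).trace
        = (Vᴴ * (B * Bᴴ) * V).trace := by
      have h : Wᴴ * H * V_RF * V * Vᴴ * V_RFᴴ * Hᴴ * W = (Bᴴ * V) * (Vᴴ * B) := by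
        rw [hBH]
        simp only [hB, Matrix.mul_assoc]
      rw [h, trace_mul_comm]
      simp only [Matrix.mul_assoc]
    have hlin : Vᴴ * V_RFᴴ * Hᴴ * W = Vᴴ * B := by simp only [hB, Matrix.mul_assoc]
    have hquad : (((β : ℂ) • V)ᴴ * M * ((β : ℂ) • V)).trace.re
        = β ^ 2 * (Vᴴ * (B * Bᴴ) * V).trace.re
          + lam * (β ^ 2 * (V_RF * V * Vᴴ * V_RFᴴ).trace.re) := by
      rw [hM, Matrix.mul_add, Matrix.add_mul, trace_add, Complex.add_re,
        Matrix.mul_smul _ (lam : ℂ), Matrix.smul_mul (lam : ℂ), trace_smul, smul_eq_mul, Complex.re_ofReal_mul,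
        re_trace_transmit_smul]
      simp only [conjTranspose_smul, Matrix.smul_mul, Matrix.mul_smul, smul_smul, trace_smul,
        Complex.star_def, Complex.conj_ofReal, smul_eq_mul, ← Complex.ofReal_mul,
        Complex.re_ofReal_mul]
      ring
    rw [hJ, hquad, hlin, trace_add, trace_add, trace_smul, trace_smul, hsig]
    simp only [conjTranspose_smul, Matrix.smul_mul, trace_smul, Complex.star_def,
      Complex.conj_ofReal, smul_eq_mul, ← Complex.ofReal_mul, ← Complex.ofReal_pow,
      Complex.add_re, Complex.re_ofReal_mul]
    linear_combination (-β ^ 2) * hlamP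
  refine ⟨hβs_pos, hpow_eq.le, fun V_D β _ hV => ?_⟩
  have hmin := hMpos.posSemidef.re_trace_quadratic_le hMVt ((β : ℂ) • V_D)
  have hslack : 0 ≤ lam * β ^ 2 * (P - (V_RF * V_D * V_Dᴴ * V_RFᴴ).trace.re) :=
    mul_nonneg (by positivity) (sub_nonneg.mpr hV)
  rw [hJ_eq, hJ_eq, hβVDs, hpow_eq, sub_self, mul_zero]
  linarith
end

section
/- Let H be an N_R×N_t complex matrix, W a nonzero N_R×N_S complex matrix, V_RF an N_t×N_RF complex matrix with full column rank, σ > 0 and P > 0 reals, and set λ = σ²·tr(WᴴW)/P, Ṽ_D = (V_RFᴴHᴴWWᴴHV_RF + λ·V_RFᴴV_RF)⁻¹ V_RFᴴHᴴW, β★ = √(tr(V_RF Ṽ_D Ṽ_Dᴴ V_RFᴴ)/P), and V_D★ = (1/β★)·Ṽ_D (assume V_RFᴴHᴴW ≠ 0 so that β★ > 0). Then the sum-MSE J(V_D★, β★) = tr(β★² WᴴH V_RF V_D★ V_D★ᴴ V_RFᴴ Hᴴ W + β★²σ² WᴴW + I_{N_S}) − 2·Re(tr(β★ V_D★ᴴ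 V_RFᴴ Hᴴ W)) satisfies J(V_D★, β★) = tr( (I_{N_S} + (1/λ)·WᴴH V_RF (V_RFᴴV_RF)⁻¹ V_RFᴴ Hᴴ W)⁻¹ ). -/
open Matrix
open scoped ComplexOrder

/-- A special case of the Woodbury identity. -/
lemma inv_one_add_smul_mul_inv_mul {n s : Type*} [Fintype n] [Fintype s] [DecidableEq n]
    [DecidableEq s] {𝕜 : Type*} [Field 𝕜] (C : Matrix s n 𝕜) (B : Matrix n s 𝕜)
    (G : Matrix n n 𝕜) {c : 𝕜} (hc : c ≠ 0) (hG : IsUnit G.det)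
    (hA : IsUnit (B * C + c • G).det) :
    (1 + c⁻¹ • (C * G⁻¹ * B))⁻¹ = 1 - C * (B * C + c • G)⁻¹ * B := by
  apply inv_eq_left_inv
  set A := B * C + c • G with hAdef
  have hBC : B * C = A - c • G := by rw [hAdef, add_sub_cancel_right]
  have key : C * A⁻¹ * B * (C * G⁻¹ * B) = C * G⁻¹ * B - c • (C * A⁻¹ * B) := by
    calc C * A⁻¹ * B * (C * G⁻¹ * B) = C * A⁻¹ * (B * C) * G⁻¹ * B := by
          simp only [Matrix.mul_assoc]
      _ = C * (A⁻¹ * A) * G⁻¹ * B - c • (C * A⁻¹ * (G * G⁻¹) * B) := by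
          rw [hBC]
          simp only [Matrix.mul_sub, Matrix.sub_mul, Matrix.mul_smul, Matrix.smul_mul,
            Matrix.mul_assoc]
      _ = _ := by
          rw [nonsing_inv_mul _ hA, mul_nonsing_inv _ hG, Matrix.mul_one, Matrix.mul_one]
  rw [Matrix.mul_add, Matrix.mul_one, Matrix.mul_smul, Matrix.sub_mul, Matrix.one_mul, key,
    sub_sub_cancel, smul_smul, inv_mul_cancel₀ hc, one_smul, sub_add_cancel]

/-- The Gram matrix of a matrix with linearly independent columns is positive definite. -/
lemma posDef_conjTranspose_mul_self_of_linearIndependent_col {m n : Type*} [Fintype m]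
    [Fintype n] (V : Matrix m n ℂ) (hV : LinearIndependent ℂ V.col) : (Vᴴ * V).PosDef :=
  PosDef.conjTranspose_mul_self V (mulVec_injective_iff.mpr hV)

lemma re_trace_mul_conjTranspose_self_pos {m n : Type*} [Fintype m] [Fintype n]
    {M : Matrix m n ℂ} (hM : M ≠ 0) : 0 < (M * Mᴴ).trace.re := by
  have h0 : 0 ≤ (M * Mᴴ).trace := (posSemidef_self_mul_conjTranspose M).trace_nonneg
  have h1 : (M * Mᴴ).trace ≠ 0 := fun h => hM (trace_mul_conjTranspose_self_eq_zero_iff.mp h)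
  exact (Complex.pos_iff.mp (lt_of_le_of_ne h0 h1.symm)).1

/-- Equation (5) of the paper: substituting the optimal digital precoder
`V_D★ = (1/β★)Ṽ_D` (and `β★`) into the sum-MSE and applying the matrix inversion
lemma gives `J(V_D★, β★) = tr((I + (1/λ) WᴴH V_RF (V_RFᴴV_RF)⁻¹ V_RFᴴ Hᴴ W)⁻¹)`. -/
theorem sum_MSE_after_optimal_digital_precoder
    {N_R N_t N_RF N_S : ℕ}
    (H : Matrix (Fin N_R) (Fin N_t) ℂ) (W : Matrix (Fin N_R) (Fin N_S) ℂ)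
    (V_RF : Matrix (Fin N_t) (Fin N_RF) ℂ)
    (hW : W ≠ 0)
    (hrank : LinearIndependent ℂ (fun j : Fin N_RF => fun i : Fin N_t => V_RF i j))
    (hWH : V_RFᴴ * Hᴴ * W ≠ 0)
    (σ P : ℝ) (hσ : 0 < σ) (hP : 0 < P)
    (J : Matrix (Fin N_RF) (Fin N_S) ℂ → ℝ → ℝ)
    (hJ : ∀ V_D β, J V_D β =
      (((β : ℂ) ^ 2 • (Wᴴ * H * V_RF * V_D * V_Dᴴ * V_RFᴴ * Hᴴ * W)
        + ((β : ℂ) ^ 2 * (σ : ℂ) ^ 2) • (Wᴴ * W) + 1).trace).re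
      - 2 * (((β : ℂ) • (V_Dᴴ * V_RFᴴ * Hᴴ * W)).trace).re)
    (lam : ℝ) (hlam : lam = σ ^ 2 * ((Wᴴ * W).trace).re / P)
    (Vt : Matrix (Fin N_RF) (Fin N_S) ℂ)
    (hVt : Vt =
      (V_RFᴴ * Hᴴ * W * Wᴴ * H * V_RF + (lam : ℂ) • (V_RFᴴ * V_RF))⁻¹ * (V_RFᴴ * Hᴴ * W))
    (βs : ℝ) (hβs : βs = Real.sqrt (((V_RF * Vt * Vtᴴ * V_RFᴴ).trace).re / P))
    (VDs : Matrix (Fin N_RF) (Fin N_S) ℂ) (hVDs : VDs = ((βs : ℂ))⁻¹ • Vt) :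
    J VDs βs =
      (((1 + ((lam : ℂ))⁻¹ • (Wᴴ * H * V_RF * (V_RFᴴ * V_RF)⁻¹ * V_RFᴴ * Hᴴ * W))⁻¹).trace).re := by
  have hG : (V_RFᴴ * V_RF).PosDef :=
    posDef_conjTranspose_mul_self_of_linearIndependent_col V_RF hrank
  have htW : 0 < (Wᴴ * W).trace.re := by
    rw [trace_mul_comm]
    exact re_trace_mul_conjTranspose_self_pos hW
  have hlam_pos : 0 < lam := by rw [hlam]; positivity
  have hlamC : (0 : ℂ) < (lam : ℂ) := by exact_mod_cast hlam_pos
  set B := V_RFᴴ * Hᴴ * W with hB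
  have hBH : Bᴴ = Wᴴ * H * V_RF := by
    simp [hB, conjTranspose_mul, Matrix.mul_assoc]
  set A := B * Bᴴ + (lam : ℂ) • (V_RFᴴ * V_RF) with hAdef
  have hA : A.PosDef := PosDef.posSemidef_add (posSemidef_self_mul_conjTranspose B)
    (hG.smul hlamC)
  have hAu : IsUnit A.det := (isUnit_iff_isUnit_det A).mp hA.isUnit
  have hGu : IsUnit (V_RFᴴ * V_RF).det := (isUnit_iff_isUnit_det _).mp hG.isUnit
  have hX : Vt = A⁻¹ * B := by
    rw [hVt, hAdef, hBH]
    simp only [Matrix.mul_assoc]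
  have hAX : A * Vt = B := by rw [hX, mul_nonsing_inv_cancel_left _ _ hAu]
  have hXB : Vtᴴ * B = Bᴴ * A⁻¹ * B := by
    rw [hX, conjTranspose_mul, conjTranspose_nonsing_inv, hA.isHermitian.eq]
  have hVX : V_RF * Vt ≠ 0 := by
    intro h
    have hX0 : Vt = 0 := by
      rw [← nonsing_inv_mul_cancel_left _ Vt hGu, Matrix.mul_assoc, h, Matrix.mul_zero,
        Matrix.mul_zero]
    exact hWH (by rw [← hAX, hX0, Matrix.mul_zero])
  have hgram : V_RF * Vt * Vtᴴ * V_RFᴴ = V_RF * Vt * (V_RF * Vt)ᴴ := by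
    rw [conjTranspose_mul, Matrix.mul_assoc (V_RF * Vt)]
  have hpow : 0 < (V_RF * Vt * Vtᴴ * V_RFᴴ).trace.re := by
    rw [hgram]
    exact re_trace_mul_conjTranspose_self_pos hVX
  have hβ_pos : 0 < βs := by rw [hβs]; exact Real.sqrt_pos.mpr (div_pos hpow hP)
  have hβ : (βs : ℂ) ≠ 0 := by exact_mod_cast hβ_pos.ne'
  have hβsq : βs ^ 2 * σ ^ 2 * (Wᴴ * W).trace.re =
      lam * (Vtᴴ * (V_RFᴴ * V_RF) * Vt).trace.re := by
    have hcyc : (Vtᴴ * (V_RFᴴ * V_RF) * Vt).trace = (V_RF * Vt * Vtᴴ * V_RFᴴ).trace := by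
      rw [hgram, trace_mul_comm (V_RF * Vt), conjTranspose_mul]
      simp only [Matrix.mul_assoc]
    rw [hcyc, hβs, Real.sq_sqrt (div_pos hpow hP).le, hlam]
    ring
  have hquad : (βs : ℂ) ^ 2 • (Wᴴ * H * V_RF * VDs * VDsᴴ * V_RFᴴ * Hᴴ * W) =
      Bᴴ * Vt * (Vtᴴ * B) := by
    rw [hVDs, hBH, hB]
    simp only [conjTranspose_smul, Matrix.mul_smul, Matrix.smul_mul, smul_smul, star_inv₀,
      RCLike.star_def, Complex.conj_ofReal, Matrix.mul_assoc]
    rw [show (βs : ℂ) ^ 2 * ((βs : ℂ)⁻¹ * (βs : ℂ)⁻¹) = 1 by field_simp, one_smul]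
  have hlin : (βs : ℂ) • (VDsᴴ * V_RFᴴ * Hᴴ * W) = Vtᴴ * B := by
    rw [hVDs, hB]
    simp only [conjTranspose_smul, Matrix.smul_mul, smul_smul, star_inv₀,
      RCLike.star_def, Complex.conj_ofReal, Matrix.mul_assoc]
    rw [mul_inv_cancel₀ hβ, one_smul]
  have hsum : (Bᴴ * Vt * (Vtᴴ * B)).trace.re + lam * (Vtᴴ * (V_RFᴴ * V_RF) * Vt).trace.re =
      (Vtᴴ * B).trace.re := by
    have hexp : Vtᴴ * B = Vtᴴ * B * (Bᴴ * Vt) + (lam : ℂ) • (Vtᴴ * (V_RFᴴ * V_RF) * Vt) := by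
      conv_lhs => rw [← hAX, hAdef]
      simp only [Matrix.add_mul, Matrix.mul_add, Matrix.smul_mul, Matrix.mul_smul,
        Matrix.mul_assoc]
    conv_rhs => rw [hexp]
    rw [trace_add, trace_smul, trace_mul_comm (Bᴴ * Vt), Complex.add_re, smul_eq_mul,
      Complex.re_ofReal_mul]
  have hwood : (1 + (lam : ℂ)⁻¹ •
      (Wᴴ * H * V_RF * (V_RFᴴ * V_RF)⁻¹ * V_RFᴴ * Hᴴ * W))⁻¹ = 1 - Vtᴴ * B := by
    rw [hXB, hAdef, ← inv_one_add_smul_mul_inv_mul Bᴴ B _ hlamC.ne' hGu hAu, hBH, hB]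
    simp only [Matrix.mul_assoc]
  have hnoise : (((βs : ℂ) ^ 2 * (σ : ℂ) ^ 2) * (Wᴴ * W).trace).re =
      βs ^ 2 * σ ^ 2 * (Wᴴ * W).trace.re := by
    rw [← Complex.re_ofReal_mul]
    push_cast
    rfl
  rw [hJ, hquad, hlin, hwood, trace_add, trace_add, trace_sub, trace_smul, smul_eq_mul,
    Complex.add_re, Complex.add_re, Complex.sub_re, hnoise, hβsq, hsum]
  ring
end

section
/- Let P be an m×m complex Hermitian positive definite matrix, X an n×m complex matrix, and λ > 0 a real number. Then tr( (Iₙ + (1/λ)·X P⁻¹ Xᴴ)⁻¹ ) = λ · tr( (XᴴX + λP)⁻¹ P ) + n − m. (Both Iₙ + (1/λ)XP⁻¹Xᴴ and XᴴX + λP are Hermitian positive definite, hence invertible.) -/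
open Matrix
open scoped ComplexOrder

/-- The trace form of the Woodbury identity for a low-rank update of the identity matrix. -/
theorem trace_one_add_mul_inv_mul_inv {m n R : Type*} [Fintype m] [DecidableEq m]
    [Fintype n] [DecidableEq n] [CommRing R] (U : Matrix n m R) (Q : Matrix m m R)
    (V : Matrix m n R) (hQ : IsUnit Q) (hS : IsUnit (V * U + Q)) :
    ((1 + U * Q⁻¹ * V)⁻¹).trace =
      ((V * U + Q)⁻¹ * Q).trace + (Fintype.card n : R) - (Fintype.card m : R) := by
  have hQdet : IsUnit Q.det := (isUnit_iff_isUnit_det Q).mp hQ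
  have hSdet : IsUnit (V * U + Q).det := (isUnit_iff_isUnit_det _).mp hS
  have hwoodbury : (1 + U * Q⁻¹ * V)⁻¹ = 1 - U * (V * U + Q)⁻¹ * V := by
    have h := add_mul_mul_inv_eq_sub 1 U Q⁻¹ V isUnit_one (isUnit_nonsing_inv_iff.mpr hQ)
      (by simpa [nonsing_inv_nonsing_inv Q hQdet, add_comm] using hS)
    simpa [nonsing_inv_nonsing_inv Q hQdet, add_comm Q] using h
  have hsum : ((V * U + Q)⁻¹ * (V * U)).trace + ((V * U + Q)⁻¹ * Q).trace =
      (Fintype.card m : R) := by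
    rw [← trace_add, ← Matrix.mul_add, nonsing_inv_mul _ hSdet, trace_one]
  rw [hwoodbury, trace_sub, trace_one, Matrix.mul_assoc, trace_mul_comm, Matrix.mul_assoc, ← hsum]
  ring

/-- The trace identity used in equation (8) of the paper: for Hermitian positive
definite `P`, any `n × m` matrix `X`, and `λ > 0`,
`tr((Iₙ + (1/λ) X P⁻¹ Xᴴ)⁻¹) = λ tr((XᴴX + λP)⁻¹ P) + n - m`. -/
theorem trace_inv_identity {m n : ℕ}
    (P : Matrix (Fin m) (Fin m) ℂ) (hP : P.PosDef)
    (X : Matrix (Fin n) (Fin m) ℂ) (lam : ℝ) (hlam : 0 < lam) :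
    ((1 + ((lam : ℂ))⁻¹ • (X * P⁻¹ * Xᴴ))⁻¹).trace =
      (lam : ℂ) * ((Xᴴ * X + (lam : ℂ) • P)⁻¹ * P).trace + (n : ℂ) - (m : ℂ) := by
  have hlam' : (0 : ℂ) < lam := by exact_mod_cast hlam
  have hQ : ((lam : ℂ) • P).PosDef := hP.smul hlam'
  have hS : (Xᴴ * X + (lam : ℂ) • P).PosDef :=
    hQ.posSemidef_add (posSemidef_conjTranspose_mul_self X)
  have hinv : ((lam : ℂ) • P)⁻¹ = (lam : ℂ)⁻¹ • P⁻¹ :=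
    inv_smul' P (Units.mk0 (lam : ℂ) hlam'.ne') ((isUnit_iff_isUnit_det P).mp hP.isUnit)
  simpa only [hinv, Matrix.mul_smul, Matrix.smul_mul, trace_smul, smul_eq_mul, Fintype.card_fin] using
    trace_one_add_mul_inv_mul_inv X ((lam : ℂ) • P) Xᴴ hQ.isUnit hS.isUnit
end

section
/- Let s ≤ m and let G be an s×m complex matrix. Then there exists an m×s complex matrix W₀ with W₀ᴴW₀ = I_s such that Re(tr(G W₀)) = Σᵢ σᵢ(G), and for every m×s complex matrix W with WᴴW = I_s it holds that Re(tr(G W)) ≤ Σᵢ σᵢ(G). Consequently, the maximum of Re(tr(GW)) over all W with orthonormal columns equals the sum of the singular values of G; a maximizer is W₀ = R₁Uᴴ, where G = U S R₁ᴴ is a compact singular value decomposition of G (U an s×s unitary, S the s×s diagonal matrix of singular values, and R₁ an m×s matrix with R₁ᴴR₁ = I_s). -/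
open Matrix
open scoped ComplexOrder

/-- **Compact singular value decomposition** of a matrix with at most as many rows as columns. -/
theorem exists_compact_svd {n p : Type*} [Fintype n] [DecidableEq n] [Fintype p]
    (e : n ↪ p) (G : Matrix n p ℂ) :
    ∃ (U : Matrix n n ℂ) (σ : n → ℝ) (R : Matrix p n ℂ),
      Uᴴ * U = 1 ∧ (∀ i, 0 ≤ σ i) ∧ Rᴴ * R = 1 ∧
      G = U * diagonal (fun i => (σ i : ℂ)) * Rᴴ := by
  classical
  have hA := isHermitian_mul_conjTranspose_self G
  set V : Matrix n n ℂ := (hA.eigenvectorUnitary : Matrix n n ℂ)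
  have hV₁ : Vᴴ * V = 1 := Unitary.coe_star_mul_self hA.eigenvectorUnitary
  have hV₂ : V * Vᴴ = 1 := Unitary.coe_mul_star_self hA.eigenvectorUnitary
  have hnonneg : ∀ i, 0 ≤ hA.eigenvalues i :=
    (posSemidef_self_mul_conjTranspose G).eigenvalues_nonneg
  set σ : n → ℝ := fun i => √(hA.eigenvalues i)
  have hσ_sq : ∀ i, (σ i : ℂ) * σ i = (hA.eigenvalues i : ℂ) := fun i => by
    rw [← Complex.ofReal_mul, Real.mul_self_sqrt (hnonneg i)]
  set H : Matrix n p ℂ := Vᴴ * G with hH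
  have hHH : H * Hᴴ = diagonal (fun i => (σ i : ℂ) * σ i) := by
    have h := hA.spectral_theorem
    rw [Unitary.conjStarAlgAut_apply] at h
    change G * Gᴴ = V * _ * Vᴴ at h
    calc H * Hᴴ = Vᴴ * (G * Gᴴ) * V := by
          simp [hH, conjTranspose_mul, Matrix.mul_assoc]
      _ = (Vᴴ * V) * diagonal (RCLike.ofReal ∘ hA.eigenvalues) * (Vᴴ * V) := by
          refine (congrArg (fun M => Vᴴ * M * V) h).trans ?_
          simp only [Matrix.mul_assoc]
      _ = _ := by
          rw [hV₁, Matrix.one_mul, Matrix.mul_one]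
          congr 1; ext i; exact (hσ_sq i).symm
  have hrow : ∀ i j, ∑ k, H i k * star (H j k) = if i = j then (σ i : ℂ) * σ i else 0 := by
    intro i j
    have := congrFun (congrFun hHH i) j
    simpa [Matrix.mul_apply, diagonal_apply] using this
  let u : n → EuclideanSpace ℂ p := fun j => WithLp.toLp 2 fun k => star (H j k) / σ j
  have hu : Orthonormal ℂ ((e '' {j | σ j ≠ 0}).domRestrict (Function.extend e u 0)) := by
    rw [orthonormal_iff_ite]
    rintro ⟨x, hx⟩ ⟨y, hy⟩
    obtain ⟨i, hi, rfl⟩ := (Set.mem_image _ _ _).mp hx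
    obtain ⟨j, hj, rfl⟩ := (Set.mem_image _ _ _).mp hy
    have hi' : (σ i : ℂ) ≠ 0 := Complex.ofReal_ne_zero.mpr hi
    have hsum : inner ℂ (u i) (u j) = (∑ k, H i k * star (H j k)) / (σ i * σ j) := by
      simp only [u, PiLp.inner_apply, RCLike.inner_apply, Finset.sum_div]
      refine Finset.sum_congr rfl fun k _ => ?_
      simp
      ring
    simp only [Set.domRestrict_apply, e.injective.extend_apply, hsum, hrow, Subtype.mk.injEq,
      e.injective.eq_iff]
    split_ifs with h
    · subst h
      field_simp
    · simp
  obtain ⟨b, hb⟩ := hu.exists_orthonormalBasis_extension_of_card_eq (by simp)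
  let R : Matrix p n ℂ := of fun k j => b (e j) k
  refine ⟨V, σ, R, hV₁, fun i => Real.sqrt_nonneg _, ?_, ?_⟩
  · ext i j
    have := orthonormal_iff_ite.mp b.orthonormal (e i) (e j)
    simp only [PiLp.inner_apply, RCLike.inner_apply, e.injective.eq_iff] at this
    rw [one_apply, ← this, Matrix.mul_apply]
    refine Finset.sum_congr rfl fun k _ => ?_
    simp [R, mul_comm]
  · have hHR : H = diagonal (fun i => (σ i : ℂ)) * Rᴴ := by
      ext j k
      rw [diagonal_mul]
      by_cases hj : σ j = 0
      · have h := hrow j j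
        have h' : H j ⬝ᵥ star (H j) = 0 := by simpa [dotProduct, hj] using h
        simp [dotProduct_self_star_eq_zero.mp h', hj]
      · have hj' : (σ j : ℂ) ≠ 0 := Complex.ofReal_ne_zero.mpr hj
        have hbj : b (e j) = u j := by
          rw [hb _ ⟨j, hj, rfl⟩, e.injective.extend_apply]
        simp [R, hbj, u]
        field_simp
    rw [Matrix.mul_assoc, ← hHR, hH, ← Matrix.mul_assoc, hV₂, Matrix.one_mul]

/-- The diagonal factor of a compact singular value decomposition of `G` lists the square roots of
the eigenvalues of `G * Gᴴ`, up to order. -/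
theorem sum_eq_sum_sqrt_eigenvalues_of_svd {n p : Type*} [Fintype n] [DecidableEq n] [Fintype p]
    {G : Matrix n p ℂ} {U : Matrix n n ℂ} {σ : n → ℝ} {R : Matrix p n ℂ}
    (hU : Uᴴ * U = 1) (hσ : ∀ i, 0 ≤ σ i) (hR : Rᴴ * R = 1)
    (hG : G = U * diagonal (fun i => (σ i : ℂ)) * Rᴴ) :
    ∑ i, σ i = ∑ i, √((isHermitian_mul_conjTranspose_self G).eigenvalues i) := by
  have hA := isHermitian_mul_conjTranspose_self G
  have hGG : G * Gᴴ = U * (diagonal (fun i => ((σ i ^ 2 : ℝ) : ℂ)) * Uᴴ) := by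
    have hD : (diagonal (fun i => (σ i : ℂ)))ᴴ = diagonal (fun i => (σ i : ℂ)) := by
      rw [diagonal_conjTranspose]; congr 1; ext i; simp
    calc G * Gᴴ = U * (diagonal (fun i => (σ i : ℂ)) * (Rᴴ * R) *
          diagonal (fun i => (σ i : ℂ)) * Uᴴ) := by
          rw [hG]
          simp only [conjTranspose_mul, conjTranspose_conjTranspose, hD, Matrix.mul_assoc]
      _ = _ := by
          rw [hR, Matrix.mul_one, diagonal_mul_diagonal]
          simp [sq]
  have hroots : (Finset.univ.val.map fun i => ((hA.eigenvalues i : ℝ) : ℂ)) =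
      Finset.univ.val.map fun i => ((σ i ^ 2 : ℝ) : ℂ) := by
    refine hA.roots_charpoly_eq_eigenvalues.symm.trans ?_
    rw [hGG, charpoly_mul_comm, Matrix.mul_assoc, hU, Matrix.mul_one, charpoly_diagonal,
      Polynomial.roots_prod _ _ (Finset.prod_ne_zero_iff.mpr fun _ _ =>
        Polynomial.X_sub_C_ne_zero _)]
    simp only [Polynomial.roots_X_sub_C, Multiset.bind_singleton]
  have h := congrArg (fun s => (s.map fun z : ℂ => √z.re).sum) hroots
  simp only [Multiset.map_map, Function.comp_def, Complex.ofReal_re, Real.sqrt_sq (hσ _)] at h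
  exact h.symm

/-- The diagonal entries of `Rᴴ * W` have real part at most one when `R` and `W` have orthonormal
columns. -/
theorem re_conjTranspose_mul_apply_self_le_one {n p : Type*} [DecidableEq n] [Fintype p]
    {R W : Matrix p n ℂ} (hR : Rᴴ * R = 1) (hW : Wᴴ * W = 1) (i : n) :
    ((Rᴴ * W) i i).re ≤ 1 := by
  have hnorm : ∀ {M : Matrix p n ℂ}, Mᴴ * M = 1 → ∑ k, ‖M k i‖ ^ 2 = 1 := fun {M} hM => by
    have h := congrArg Complex.re (congrFun (congrFun hM i) i)
    simpa [Matrix.mul_apply, Complex.sq_norm, Complex.normSq_apply] using h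
  have hle : ((Rᴴ * W) i i).re ≤ ∑ k, (‖R k i‖ ^ 2 + ‖W k i‖ ^ 2) / 2 := by
    rw [Matrix.mul_apply, Complex.re_sum]
    refine Finset.sum_le_sum fun k _ => ?_
    calc (Rᴴ i k * W k i).re ≤ ‖Rᴴ i k * W k i‖ := Complex.re_le_norm _
      _ = ‖R k i‖ * ‖W k i‖ := by simp
      _ ≤ _ := by nlinarith [sq_nonneg (‖R k i‖ - ‖W k i‖)]
  rw [← Finset.sum_div, Finset.sum_add_distrib, hnorm hR, hnorm hW] at hle
  linarith

/-- The trace against a matrix with orthonormal columns is at most the sum of the diagonal factor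
of a compact singular value decomposition. -/
theorem re_trace_mul_le_sum_of_svd {n p : Type*} [Fintype n] [DecidableEq n] [Fintype p]
    {U : Matrix n n ℂ} {σ : n → ℝ} {R W : Matrix p n ℂ}
    (hU : Uᴴ * U = 1) (hσ : ∀ i, 0 ≤ σ i) (hR : Rᴴ * R = 1) (hW : Wᴴ * W = 1) :
    (U * diagonal (fun i => (σ i : ℂ)) * Rᴴ * W).trace.re ≤ ∑ i, σ i := by
  have hWU : (W * U)ᴴ * (W * U) = 1 := by
    rw [conjTranspose_mul, Matrix.mul_assoc, ← Matrix.mul_assoc Wᴴ, hW, Matrix.one_mul, hU]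
  have htr : (U * diagonal (fun i => (σ i : ℂ)) * Rᴴ * W).trace =
      (diagonal (fun i => (σ i : ℂ)) * (Rᴴ * (W * U))).trace := by
    rw [Matrix.mul_assoc, Matrix.mul_assoc, trace_mul_comm]
    simp only [Matrix.mul_assoc]
  rw [htr, trace, Complex.re_sum]
  refine Finset.sum_le_sum fun i _ => ?_
  rw [diag_apply, diagonal_mul, Complex.re_ofReal_mul]
  exact mul_le_of_le_one_right (hσ i) (re_conjTranspose_mul_apply_self_le_one hR hWU i)

/-- For a compact singular value decomposition `U * diagonal σ * Rᴴ`, the matrix `R * Uᴴ` attains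
the sum of the diagonal factor. -/
theorem re_trace_svd_mul_eq_sum {n p : Type*} [Fintype n] [DecidableEq n] [Fintype p]
    {U : Matrix n n ℂ} {σ : n → ℝ} {R : Matrix p n ℂ}
    (hU : Uᴴ * U = 1) (hR : Rᴴ * R = 1) :
    (U * diagonal (fun i => (σ i : ℂ)) * Rᴴ * (R * Uᴴ)).trace.re = ∑ i, σ i := by
  rw [Matrix.mul_assoc, ← Matrix.mul_assoc Rᴴ, hR, Matrix.one_mul, Matrix.mul_assoc,
    trace_mul_comm, Matrix.mul_assoc, hU, Matrix.mul_one, trace_diagonal, Complex.re_sum]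
  simp

/-- Closed-form optimal digital combiner (Section III-B of the paper): for `s ≤ m` and
an `s × m` matrix `G`, the maximum of `Re(tr(GW))` over `m × s` matrices `W` with
orthonormal columns (`WᴴW = I`) equals the sum of the singular values of `G`
(`σᵢ(G) = √(eigenvalueᵢ(GGᴴ))`), and it is attained; moreover `W₀ = R₁Uᴴ` is a
maximizer for any compact SVD `G = U S R₁ᴴ`. -/
theorem optimal_digital_combiner {s m : ℕ} (hsm : s ≤ m)
    (G : Matrix (Fin s) (Fin m) ℂ) :
    (∃ W₀ : Matrix (Fin m) (Fin s) ℂ, W₀ᴴ * W₀ = 1 ∧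
      ((G * W₀).trace).re =
        ∑ i : Fin s, Real.sqrt ((Matrix.isHermitian_mul_conjTranspose_self G).eigenvalues i)) ∧
    (∀ W : Matrix (Fin m) (Fin s) ℂ, Wᴴ * W = 1 →
      ((G * W).trace).re ≤
        ∑ i : Fin s, Real.sqrt ((Matrix.isHermitian_mul_conjTranspose_self G).eigenvalues i)) ∧
    (∀ (U : Matrix (Fin s) (Fin s) ℂ) (σ' : Fin s → ℝ) (R₁ : Matrix (Fin m) (Fin s) ℂ),
      Uᴴ * U = 1 → (∀ i, 0 ≤ σ' i) → R₁ᴴ * R₁ = 1 →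
      G = U * Matrix.diagonal (fun i => (σ' i : ℂ)) * R₁ᴴ →
      ((G * (R₁ * Uᴴ)).trace).re =
        ∑ i : Fin s, Real.sqrt ((Matrix.isHermitian_mul_conjTranspose_self G).eigenvalues i)) := by
  have hmax : ∀ (U : Matrix (Fin s) (Fin s) ℂ) (σ' : Fin s → ℝ) (R₁ : Matrix (Fin m) (Fin s) ℂ),
      Uᴴ * U = 1 → (∀ i, 0 ≤ σ' i) → R₁ᴴ * R₁ = 1 →
      G = U * diagonal (fun i => (σ' i : ℂ)) * R₁ᴴ →
      (G * (R₁ * Uᴴ)).trace.re =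
        ∑ i, √((isHermitian_mul_conjTranspose_self G).eigenvalues i) := by
    intro U σ' R₁ hU hσ hR hG
    rw [← sum_eq_sum_sqrt_eigenvalues_of_svd hU hσ hR hG, hG]
    exact re_trace_svd_mul_eq_sum hU hR
  obtain ⟨U, σ, R, hU, hσ, hR, hG⟩ := exists_compact_svd (Fin.castLEEmb hsm) G
  refine ⟨⟨R * Uᴴ, ?_, hmax U σ R hU hσ hR hG⟩, fun W hW => ?_, hmax⟩
  · rw [conjTranspose_mul, Matrix.mul_assoc, ← Matrix.mul_assoc Rᴴ, hR, Matrix.one_mul,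
      conjTranspose_conjTranspose, mul_eq_one_comm.mp hU]
  · rw [← sum_eq_sum_sqrt_eigenvalues_of_svd hU hσ hR hG, hG]
    exact re_trace_mul_le_sum_of_svd hU hσ hR hW
end

section
/- Let η > 0 be a real, let K ≥ 1, and for each k = 1, …, K let H̄_k be an N_r×N complex matrix, W_k an N_r×m complex matrix, and Z_k an m×m unitary complex matrix; let Ω = blkdiag(I_s, 0) be the m×m matrix with ones in the first s ≤ m diagonal entries and zeros elsewhere. Then tr( (Σ_{k=1}^K H̄_kᴴ W_k Z_k Ω Z_kᴴ W_kᴴ H̄_k + η·I_N)⁻¹ ) ≥ tr( (Σ_{k=1}^K H̄_kᴴ W_k W_kᴴ H̄_k + η·I_N)⁻¹ ). (Both matrices being inverted are Hermitian positive definite, hence invertible.) -/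
open Matrix
open scoped ComplexOrder

/-- Inversion is antitone on positive definite matrices for the Loewner order. -/
theorem Matrix.PosDef.posSemidef_inv_sub_inv_s11 {n : Type*} [Fintype n] [DecidableEq n]
    {A B : Matrix n n ℂ} (hA : A.PosDef) (hB : B.PosDef) (hAB : (B - A).PosSemidef) :
    (A⁻¹ - B⁻¹).PosSemidef := by
  have hAdet : IsUnit A.det := (Matrix.isUnit_iff_isUnit_det A).mp hA.isUnit
  have hBdet : IsUnit B.det := (Matrix.isUnit_iff_isUnit_det B).mp hB.isUnit
  have hBinv : B⁻¹ᴴ = B⁻¹ := hB.inv.isHermitian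
  have hD : (B - A)ᴴ = B - A := hAB.isHermitian
  have left : A⁻¹ - B⁻¹ = B⁻¹ * (B - A) * A⁻¹ := by
    rw [mul_sub, sub_mul, Matrix.nonsing_inv_mul _ hBdet, one_mul,
      Matrix.mul_nonsing_inv_cancel_right _ _ hAdet]
  have right : A⁻¹ = B⁻¹ + A⁻¹ * (B - A) * B⁻¹ := by
    rw [mul_sub, sub_mul, Matrix.nonsing_inv_mul _ hAdet, one_mul,
      Matrix.mul_nonsing_inv_cancel_right _ _ hBdet, add_sub_cancel]
  have split : A⁻¹ - B⁻¹ =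
      B⁻¹ᴴ * (B - A) * B⁻¹ + ((B - A) * B⁻¹)ᴴ * A⁻¹ * ((B - A) * B⁻¹) := by
    rw [Matrix.conjTranspose_mul, hBinv, hD]
    calc A⁻¹ - B⁻¹ = B⁻¹ * (B - A) * A⁻¹ := left
      _ = B⁻¹ * (B - A) * (B⁻¹ + A⁻¹ * (B - A) * B⁻¹) := by rw [← right]
      _ = _ := by rw [mul_add]; simp only [mul_assoc]
  rw [split]
  exact (hAB.conjTranspose_mul_mul_same _).add
    (hA.inv.posSemidef.conjTranspose_mul_mul_same _)

/-- The multiuser lower bound of Section III-B of the paper (obtained from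
Proposition 1): with unitary `Z_k` and `Ω = blkdiag(I_s, 0)`,
`tr((Σₖ H̄ₖᴴ Wₖ Zₖ Ω Zₖᴴ Wₖᴴ H̄ₖ + η I)⁻¹) ≥ tr((Σₖ H̄ₖᴴ Wₖ Wₖᴴ H̄ₖ + η I)⁻¹)`. -/
theorem multiuser_trace_inv_lower_bound {K N_r N m s : ℕ}
    (hK : 1 ≤ K) (hsm : s ≤ m) (η : ℝ) (hη : 0 < η)
    (Hbar : Fin K → Matrix (Fin N_r) (Fin N) ℂ)
    (W : Fin K → Matrix (Fin N_r) (Fin m) ℂ)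
    (Z : Fin K → Matrix (Fin m) (Fin m) ℂ)
    (hZ : ∀ k, Z k ∈ Matrix.unitaryGroup (Fin m) ℂ)
    (Ω : Matrix (Fin m) (Fin m) ℂ)
    (hΩ : Ω = Matrix.diagonal (fun i : Fin m => if (i : ℕ) < s then (1 : ℂ) else 0)) :
    ((∑ k : Fin K, (Hbar k)ᴴ * W k * Z k * Ω * (Z k)ᴴ * (W k)ᴴ * Hbar k
        + (η : ℂ) • (1 : Matrix (Fin N) (Fin N) ℂ))⁻¹).trace ≥
    ((∑ k : Fin K, (Hbar k)ᴴ * W k * (W k)ᴴ * Hbar k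
        + (η : ℂ) • (1 : Matrix (Fin N) (Fin N) ℂ))⁻¹).trace := by
  have hη' : ((η : ℂ) • (1 : Matrix (Fin N) (Fin N) ℂ)).PosDef :=
    Matrix.PosDef.one.smul (by exact_mod_cast hη)
  have hΩ_nonneg : Ω.PosSemidef := by
    rw [hΩ]
    refine Matrix.PosSemidef.diagonal fun i => ?_
    by_cases h : (i : ℕ) < s <;> simp [h]
  have hΩ_le_one : (1 - Ω).PosSemidef := by
    rw [hΩ, ← Matrix.diagonal_one, Matrix.diagonal_sub]
    refine Matrix.PosSemidef.diagonal fun i => ?_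
    by_cases h : (i : ℕ) < s <;> simp [h]
  have hA : (∑ k : Fin K, (Hbar k)ᴴ * W k * Z k * Ω * (Z k)ᴴ * (W k)ᴴ * Hbar k
      + (η : ℂ) • (1 : Matrix (Fin N) (Fin N) ℂ)).PosDef := by
    refine Matrix.PosDef.posSemidef_add (Matrix.posSemidef_sum _ fun k _ => ?_) hη'
    simpa [Matrix.mul_assoc] using
      hΩ_nonneg.conjTranspose_mul_mul_same ((Z k)ᴴ * (W k)ᴴ * Hbar k)
  have hB : (∑ k : Fin K, (Hbar k)ᴴ * W k * (W k)ᴴ * Hbar k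
      + (η : ℂ) • (1 : Matrix (Fin N) (Fin N) ℂ)).PosDef := by
    refine Matrix.PosDef.posSemidef_add (Matrix.posSemidef_sum _ fun k _ => ?_) hη'
    simpa [Matrix.mul_assoc] using
      Matrix.posSemidef_conjTranspose_mul_self ((W k)ᴴ * Hbar k)
  have hdiff := hA.posSemidef_inv_sub_inv_s11 hB (by
    rw [add_sub_add_right_eq_sub, ← Finset.sum_sub_distrib]
    refine Matrix.posSemidef_sum _ fun k _ => ?_
    have hZZ : Z k * (Z k)ᴴ = 1 := Matrix.mem_unitaryGroup_iff.mp (hZ k)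
    have hterm : (Hbar k)ᴴ * W k * (W k)ᴴ * Hbar k
        - (Hbar k)ᴴ * W k * Z k * Ω * (Z k)ᴴ * (W k)ᴴ * Hbar k
        = ((Z k)ᴴ * (W k)ᴴ * Hbar k)ᴴ * (1 - Ω) * ((Z k)ᴴ * (W k)ᴴ * Hbar k) := by
      have hcancel : Z k * ((Z k)ᴴ * ((W k)ᴴ * Hbar k)) = (W k)ᴴ * Hbar k := by
        rw [← Matrix.mul_assoc, hZZ, Matrix.one_mul]
      simp [Matrix.mul_assoc, Matrix.mul_sub, Matrix.sub_mul, hcancel]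
    rw [hterm]
    exact hΩ_le_one.conjTranspose_mul_mul_same _)
  have htrace := hdiff.trace_nonneg
  rw [Matrix.trace_sub] at htrace
  exact sub_nonneg.mp htrace
end
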